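/- arXiv:0807.1826 — 2 statements merged into one kernel-verified Lean document; each statement's English description precedes it below -/
import Mathlib

section
/- Let k have a quadratic field extension l̄ = k[x]/(p(x)) with p irreducible of degree 2. Every twisted tensor product kⁿ ⊗_{(f,δ)} l̄ is isomorphic to M₂(k)ᵗ × l̄ʳ, where t is the number of strict 2-cycles and r the number of strict 1-cycles (loops) in the quiver Q_f associated to f, and moreover 2t + r = n. -/
open Polynomial in
theorem quad_data {k : Type*} [Field k] (p : Polynomial k)
    (hdeg : p.degree = 2) (hirr : Irreducible p) :
    ∃ α β : k, (∀ s : k, s * s - α * s - β ≠ 0) ∧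
      AdjoinRoot.root p * AdjoinRoot.root p =
        α • AdjoinRoot.root p + algebraMap k (AdjoinRoot p) β := by
  have hnd : p.natDegree = 2 := natDegree_eq_of_degree_eq_some hdeg
  have ha : p.coeff 2 ≠ 0 := by
    rw [← hnd]; exact leadingCoeff_ne_zero.mpr hirr.ne_zero
  have hp : p = C (p.coeff 2) * X ^ 2 + C (p.coeff 1) * X + C (p.coeff 0) :=
    eq_quadratic_of_degree_le_two hdeg.le
  refine ⟨-(p.coeff 1) / p.coeff 2, -(p.coeff 0) / p.coeff 2, ?_, ?_⟩
  · intro s hs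
    have hroot : p.IsRoot s := by
      rw [IsRoot, hp]
      simp only [eval_add, eval_mul, eval_C, eval_pow, eval_X]
      field_simp at hs
      linear_combination hs
    have := degree_eq_one_of_irreducible_of_root hirr hroot
    rw [hdeg] at this
    exact absurd this (by decide)
  · have h0 : aeval (AdjoinRoot.root p) p = 0 := by
      rw [aeval_def]; exact AdjoinRoot.eval₂_root p
    have h1 := h0
    conv at h1 => enter [1, 2]; rw [hp]
    simp only [map_add, map_mul, aeval_C, map_pow, aeval_X] at h1
    have h2 : algebraMap k (AdjoinRoot p) (p.coeff 2)⁻¹ *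
        algebraMap k (AdjoinRoot p) (p.coeff 2) = 1 := by
      rw [← map_mul, inv_mul_cancel₀ ha, map_one]
    rw [Algebra.smul_def, neg_div, neg_div, div_eq_mul_inv, div_eq_mul_inv]
    simp only [map_neg, map_mul]
    linear_combination (algebraMap k (AdjoinRoot p) (p.coeff 2)⁻¹) * h1 -
      (AdjoinRoot.root p) ^ 2 * h2

theorem card_moved {n : ℕ} (φ : Fin n → Fin n) (h : ∀ i, φ (φ i) = i) :
    (Finset.univ.filter fun i : Fin n => φ i ≠ i).card =
      2 * (Finset.univ.filter fun i : Fin n => i < φ i).card := by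
  have h1 : (Finset.univ.filter fun i : Fin n => φ i ≠ i) =
      (Finset.univ.filter fun i : Fin n => i < φ i) ∪
      (Finset.univ.filter fun i : Fin n => φ i < i) := by
    ext i; simp only [Finset.mem_filter, Finset.mem_univ, true_and, Finset.mem_union]
    rw [ne_iff_lt_or_gt]; exact or_comm
  have h2 : (Finset.univ.filter fun i : Fin n => φ i < i).card =
      (Finset.univ.filter fun i : Fin n => i < φ i).card := by
    refine Finset.card_bij (fun i _ => φ i) ?_ ?_ ?_
    · intro i hi; simpa [h] using hi
    · intro i _ j _ hij
      rw [← h i, ← h j]; exact congrArg φ hij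
    · intro j hj
      exact ⟨φ j, by simpa [h] using hj, h j⟩
  rw [h1, Finset.card_union_of_disjoint, h2, two_mul]
  rw [Finset.disjoint_filter]
  intro i _ h3 h4
  exact absurd h3 (not_lt.mpr h4.le)

/-- The components of the isomorphism. -/
noncomputable def psiLin {k : Type*} [Field k] {n t r : ℕ} (p : Polynomial k)
    (φ : Fin n → Fin n) (v : Fin n → k) (e1 : Fin t → Fin n) (e2 : Fin r → Fin n) :
    ((Fin n → k) × (Fin n → k)) →ₗ[k]
      ((Fin t → Matrix (Fin 2) (Fin 2) k) × (Fin r → AdjoinRoot p)) where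
  toFun c := (fun s => !![c.1 (e1 s), c.2 (e1 s) * v (e1 s); c.2 (φ (e1 s)), c.1 (φ (e1 s))],
    fun s => algebraMap k _ (c.1 (e2 s)) + algebraMap k _ (c.2 (e2 s)) * AdjoinRoot.root p)
  map_add' c d := by
    refine Prod.ext ?_ ?_
    · funext s
      ext i j
      fin_cases i <;> fin_cases j <;> simp [add_mul]
    · funext s
      simp only [Prod.fst_add, Prod.snd_add, Pi.add_apply, map_add]
      ring
  map_smul' a c := by
    refine Prod.ext ?_ ?_
    · funext s
      ext i j
      fin_cases i <;> fin_cases j <;> simp [mul_assoc]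
    · funext s
      simp only [Prod.smul_fst, Prod.smul_snd, Pi.smul_apply, smul_eq_mul, map_mul,
        RingHom.id_apply]
      rw [Algebra.smul_def]
      ring

theorem root_indep {k : Type*} [Field k] (p : Polynomial k)
    (hdeg : p.degree = 2) (a b : k)
    (h : algebraMap k (AdjoinRoot p) a + algebraMap k _ b * AdjoinRoot.root p = 0) :
    a = 0 ∧ b = 0 := by
  have h1 : AdjoinRoot.mk p (Polynomial.C a + Polynomial.C b * Polynomial.X) = 0 := by
    rw [← h]; simp [AdjoinRoot.algebraMap_eq]
  rw [AdjoinRoot.mk_eq_zero] at h1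
  have h2 : Polynomial.C a + Polynomial.C b * Polynomial.X = 0 := by
    refine Polynomial.eq_zero_of_dvd_of_degree_lt h1 ?_
    rw [hdeg, add_comm]
    exact lt_of_le_of_lt Polynomial.degree_linear_le (by decide)
  constructor
  · simpa using congrArg (fun q => Polynomial.coeff q 0) h2
  · simpa using congrArg (fun q => Polynomial.coeff q 1) h2

theorem final_iso {k : Type*} [Field k] {n t r : ℕ} (p : Polynomial k)
    (hdeg : p.degree = 2) {α β : k}
    (hsq : AdjoinRoot.root p * AdjoinRoot.root p =
        α • AdjoinRoot.root p + algebraMap k (AdjoinRoot p) β)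
    (X : Type*) [Ring X] [Algebra k X]
    (ιA : (Fin n → k) →ₐ[k] X) (y : X) (φ : Fin n → Fin n) (u v : Fin n → k)
    (hyg : ∀ g, y * ιA g = ιA (g ∘ φ) * y)
    (hyy : y * y = ιA u * y + ιA v)
    (hinjy : ∀ a b a' b' : Fin n → k, ιA a + ιA b * y = ιA a' + ιA b' * y →
      a = a' ∧ b = b')
    (hsurjy : ∀ z : X, ∃ a b : Fin n → k, ιA a + ιA b * y = z)
    (hvne : ∀ j, v j ≠ 0) (hφ : ∀ i, φ (φ i) = i)
    (hu0 : ∀ j, φ j ≠ j → u j = 0) (hvφ : ∀ j, v (φ j) = v j)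
    (hu1 : ∀ j, φ j = j → u j = α) (hv1 : ∀ j, φ j = j → v j = β)
    (hcard : 2 * t + r = n) (e1 : Fin t → Fin n) (e2 : Fin r → Fin n)
    (he1 : ∀ i, i < φ i → ∃ s, e1 s = i) (he2 : ∀ i, φ i = i → ∃ s, e2 s = i)
    (he1' : ∀ s, φ (e1 s) ≠ e1 s) (he2' : ∀ s, φ (e2 s) = e2 s) :
    Nonempty (X ≃ₐ[k] ((Fin t → Matrix (Fin 2) (Fin 2) k) × (Fin r → AdjoinRoot p))) := by
  have hp0 : p ≠ 0 := by rintro rfl; simp at hdeg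
  have hnd : p.natDegree = 2 := Polynomial.natDegree_eq_of_degree_eq_some hdeg
  let pb := AdjoinRoot.powerBasis hp0
  have : Module.Finite k (AdjoinRoot p) := pb.finite
  have hfr : Module.finrank k (AdjoinRoot p) = 2 := by
    rw [pb.finrank, AdjoinRoot.powerBasis_dim, hnd]
  -- the linear coordinates on `X`
  let E0 : ((Fin n → k) × (Fin n → k)) →ₗ[k] X :=
    ιA.toLinearMap.coprod ((LinearMap.mulRight k y).comp ιA.toLinearMap)
  have hE0 : ∀ c, E0 c = ιA c.1 + ιA c.2 * y := fun c => by simp [E0]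
  have hE0b : Function.Bijective E0 := by
    constructor
    · rintro ⟨a, b⟩ ⟨a', b'⟩ h
      rw [hE0, hE0] at h
      obtain ⟨h1, h2⟩ := hinjy _ _ _ _ h
      exact Prod.ext h1 h2
    · intro z
      obtain ⟨a, b, h⟩ := hsurjy z
      exact ⟨(a, b), by rw [hE0]; exact h⟩
  let E := LinearEquiv.ofBijective E0 hE0b
  have hE : ∀ c, E c = ιA c.1 + ιA c.2 * y := hE0
  let L := psiLin p φ v e1 e2
  have hLinj : Function.Injective L := by
    rw [injective_iff_map_eq_zero]
    intro c hc
    have hM : ∀ s, !![c.1 (e1 s), c.2 (e1 s) * v (e1 s); c.2 (φ (e1 s)), c.1 (φ (e1 s))]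
        = (0 : Matrix (Fin 2) (Fin 2) k) := fun s => congrFun (congrArg Prod.fst hc) s
    have hR : ∀ s, algebraMap k (AdjoinRoot p) (c.1 (e2 s)) +
        algebraMap k _ (c.2 (e2 s)) * AdjoinRoot.root p = 0 :=
      fun s => congrFun (congrArg Prod.snd hc) s
    have hM' : ∀ i, i < φ i → c.1 i = 0 ∧ c.2 i = 0 ∧ c.1 (φ i) = 0 ∧ c.2 (φ i) = 0 := by
      intro i hi
      obtain ⟨s, rfl⟩ := he1 i hi
      have h00 := congrFun (congrFun (hM s) 0) 0
      have h01 := congrFun (congrFun (hM s) 0) 1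
      have h10 := congrFun (congrFun (hM s) 1) 0
      have h11 := congrFun (congrFun (hM s) 1) 1
      simp [hvne] at h00 h01 h10 h11
      exact ⟨h00, h01, h11, h10⟩
    have hall : ∀ i, c.1 i = 0 ∧ c.2 i = 0 := by
      intro i
      rcases lt_trichotomy i (φ i) with h | h | h
      · exact ⟨(hM' i h).1, (hM' i h).2.1⟩
      · obtain ⟨s, rfl⟩ := he2 i h.symm
        exact root_indep p hdeg _ _ (hR s)
      · have := hM' (φ i) (by rw [hφ]; exact h)
        rw [hφ] at this
        exact this.2.2
    exact Prod.ext (funext fun i => (hall i).1) (funext fun i => (hall i).2)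
  have hdim : Module.finrank k ((Fin n → k) × (Fin n → k)) =
      Module.finrank k ((Fin t → Matrix (Fin 2) (Fin 2) k) × (Fin r → AdjoinRoot p)) := by
    rw [Module.finrank_prod, Module.finrank_prod, Module.finrank_pi_fintype,
      Module.finrank_pi_fintype, Module.finrank_pi_fintype]
    simp only [Module.finrank_matrix, hfr, Finset.sum_const, Finset.card_univ, Fintype.card_fin,
      Module.finrank_self, smul_eq_mul]
    omega
  have hLbij : Function.Bijective L :=
    ⟨hLinj, (LinearMap.injective_iff_surjective_of_finrank_eq_finrank hdim).1 hLinj⟩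
  have hprod : ∀ c d, E c * E d = E (c.1 * d.1 + c.2 * (d.2 ∘ φ) * v,
      c.1 * d.2 + c.2 * (d.1 ∘ φ) + c.2 * (d.2 ∘ φ) * u) := by
    intro c d
    have h1 : ιA c.2 * y * ιA d.1 = ιA c.2 * ιA (d.1 ∘ φ) * y := by
      rw [mul_assoc, hyg, mul_assoc]
    have h2 : ιA c.2 * y * (ιA d.2 * y) = ιA c.2 * ιA (d.2 ∘ φ) * ιA u * y +
        ιA c.2 * ιA (d.2 ∘ φ) * ιA v := by
      rw [mul_assoc, ← mul_assoc y, hyg, mul_assoc _ y y, hyy]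
      simp only [mul_add, mul_assoc]
    rw [hE, hE, hE, add_mul, mul_add, mul_add, h1, h2]
    simp only [map_add, map_mul, add_mul, mul_assoc]
    abel
  have hLmul : ∀ c d : (Fin n → k) × (Fin n → k), L (c.1 * d.1 + c.2 * (d.2 ∘ φ) * v,
      c.1 * d.2 + c.2 * (d.1 ∘ φ) + c.2 * (d.2 ∘ φ) * u) = L c * L d := by
    intro c d
    refine Prod.ext ?_ ?_
    · funext s
      have hu := hu0 _ (he1' s)
      have hu' := hu0 (φ (e1 s)) (by rw [hφ]; exact (he1' s).symm)
      have hv' := hvφ (e1 s)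
      ext i j
      fin_cases i <;> fin_cases j <;>
        simp [L, psiLin, Matrix.mul_apply, Fin.sum_univ_two, hu, hu', hv', hφ] <;> ring
    · funext s
      have h := he2' s
      have hu := hu1 _ h
      have hv' := hv1 _ h
      rw [Algebra.smul_def] at hsq
      simp only [L, psiLin, LinearMap.coe_mk, AddHom.coe_mk, Prod.snd_mul, Pi.mul_apply,
        Pi.add_apply, Function.comp_apply, h, hu, hv', map_add, map_mul]
      linear_combination (-(algebraMap k (AdjoinRoot p) (c.2 (e2 s)) *
        algebraMap k (AdjoinRoot p) (d.2 (e2 s)))) * hsq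
  have hE1 : E.symm 1 = (1, 0) := by
    rw [LinearEquiv.symm_apply_eq, hE]; simp
  have hL1 : L (1, 0) = 1 := by
    refine Prod.ext ?_ ?_
    · funext s
      ext i j
      fin_cases i <;> fin_cases j <;> simp [L, psiLin]
    · funext s
      simp [L, psiLin]
  let F : X ≃ₗ[k] _ := E.symm.trans (LinearEquiv.ofBijective L hLbij)
  have hF : ∀ z, F z = L (E.symm z) := fun z => rfl
  refine ⟨AlgEquiv.ofLinearEquiv F ?_ ?_⟩
  · rw [hF, hE1, hL1]
  · intro z w
    obtain ⟨c, rfl⟩ := E.surjective z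
    obtain ⟨d, rfl⟩ := E.surjective w
    rw [hF, hF, hF, hprod]
    simp only [LinearEquiv.symm_apply_apply]
    exact hLmul c d

theorem stmt7 {k : Type*} [Field k] (n : ℕ) (p : Polynomial k)
    (hdeg : p.degree = 2) (hirr : Irreducible p)
    (X : Type*) [Ring X] [Algebra k X]
    (ιA : (Fin n → k) →ₐ[k] X) (ιB : AdjoinRoot p →ₐ[k] X)
    (hA : Function.Injective ιA) (hB : Function.Injective ιB)
    (hfact : Function.Bijective (fun c : (Fin n → k) × (Fin n → k) =>
      ιA c.1 + ιA c.2 * ιB (AdjoinRoot.root p)))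
    (φ : Fin n → Fin n) (δ : (Fin n → k) →ₗ[k] (Fin n → k))
    (hrel : ∀ g : Fin n → k,
      ιB (AdjoinRoot.root p) * ιA g = ιA (δ g) + ιA (g ∘ φ) * ιB (AdjoinRoot.root p)) :
    (∀ i, φ (φ i) = i) ∧
    2 * ((Finset.univ.filter fun i : Fin n => φ i ≠ i).card / 2) +
      (Finset.univ.filter fun i : Fin n => φ i = i).card = n ∧
    Nonempty (X ≃ₐ[k]
      ((Fin ((Finset.univ.filter fun i : Fin n => φ i ≠ i).card / 2) →
          Matrix (Fin 2) (Fin 2) k) ×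
        (Fin ((Finset.univ.filter fun i : Fin n => φ i = i).card) → AdjoinRoot p))) := by
  obtain ⟨α, β, hnr, hsq⟩ := quad_data p hdeg hirr
  set x := ιB (AdjoinRoot.root p) with hx
  have hxx : x * x = ιA (fun _ => α) * x + ιA (fun _ => β) := by
    have h1 : ∀ a : k, ιA (fun _ => a) = algebraMap k X a := fun a => ιA.commutes a
    rw [h1, h1, hx, ← map_mul, hsq, map_add, map_smul, AlgHom.commutes, Algebra.smul_def]
  have hinj : ∀ a b a' b' : Fin n → k, ιA a + ιA b * x = ιA a' + ιA b' * x →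
      a = a' ∧ b = b' := by
    intro a b a' b' h
    have := hfact.1 (a₁ := (a, b)) (a₂ := (a', b')) h
    exact ⟨congrArg Prod.fst this, congrArg Prod.snd this⟩
  -- twisted derivation
  have hder : ∀ g h : Fin n → k, δ (g * h) = δ g * h + (g ∘ φ) * δ h := by
    intro g h
    have h1 : ιA (δ (g * h)) + ιA ((g * h) ∘ φ) * x =
        ιA (δ g * h + (g ∘ φ) * δ h) + ιA ((g ∘ φ) * (h ∘ φ)) * x := by
      rw [← hrel, map_mul, ← mul_assoc, hrel, add_mul, mul_assoc, hrel]
      simp only [map_add, map_mul, mul_add, mul_assoc, add_assoc]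
    exact (hinj _ _ _ _ h1).1
  have hderj : ∀ (g h : Fin n → k) j, δ (g * h) j = δ g j * h j + g (φ j) * δ h j := by
    intro g h j; rw [hder]; rfl
  obtain ⟨c, hc0, hc⟩ : ∃ c : Fin n → k, (∀ j, φ j = j → c j = 0) ∧
      ∀ g j, δ g j = c j * (g (φ j) - g j) := by
    have hz : ∀ j, φ j = j → δ (Pi.single j 1) j = 0 := by
      intro j hj
      have h1 := hderj (Pi.single j 1) (Pi.single j 1) j
      rw [← Pi.single_mul, hj] at h1
      simpa using h1
    refine ⟨fun j => - δ (Pi.single j 1) j, ?_, ?_⟩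
    · intro j hj; simp [hz j hj]
    · intro g j
      by_cases hj : φ j = j
      · have h1 := hderj g (Pi.single j 1) j
        have h2 : g * Pi.single j 1 = g j • Pi.single j (1 : k) := by
          ext i
          by_cases hi : i = j
          · subst hi; simp
          · simp [hi]
        rw [h2, map_smul, Pi.smul_apply, hz j hj] at h1
        simp at h1
        rw [← h1]; simp [hj]
      · have h1 := hderj g (Pi.single j 1) j
        rw [mul_comm g, hderj] at h1
        simp [hj] at h1
        linear_combination -h1
  have hδ : ∀ g, δ g = c * (g ∘ φ - g) := fun g => funext fun j => hc g j
  -- the new generator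
  set y := x + ιA c with hy
  have hyg : ∀ g, y * ιA g = ιA (g ∘ φ) * y := by
    intro g
    have h1 : ιA c * ιA g = ιA g * ιA c := by rw [← map_mul, mul_comm, map_mul]
    have h2 : ιA c * ιA (g ∘ φ) = ιA (g ∘ φ) * ιA c := by rw [← map_mul, mul_comm, map_mul]
    rw [hy, add_mul, hrel, hδ, mul_add, map_mul, map_sub, mul_sub, h1, h2]
    abel
  obtain ⟨u, hu⟩ : ∃ u : Fin n → k, u = (fun _ => α) + c + c ∘ φ := ⟨_, rfl⟩
  obtain ⟨v, hv⟩ : ∃ v : Fin n → k, v = (fun _ => β) - (fun _ => α) * c - c * c := ⟨_, rfl⟩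
  have hyy : y * y = ιA u * y + ιA v := by
    have e1 : y * y = ιA ((fun _ => α) + c + c ∘ φ) * x +
        ιA ((fun _ => β) + c * (c ∘ φ)) := by
      rw [hy, add_mul, mul_add, mul_add, hxx, hrel, hδ]
      simp only [map_add, map_mul, map_sub, mul_sub, add_mul]
      abel
    have e2 : (fun _ => β) + c * (c ∘ φ) = u * c + v := by
      rw [hu, hv]; ring
    rw [e1, e2, ← hu, hy, map_add, map_mul, mul_add, add_assoc]
  have hinjy : ∀ a b a' b' : Fin n → k, ιA a + ιA b * y = ιA a' + ιA b' * y →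
      a = a' ∧ b = b' := by
    intro a b a' b' h
    have h1 : ιA (a + b * c) + ιA b * x = ιA (a' + b' * c) + ιA b' * x := by
      simp only [map_add, map_mul]
      calc _ = ιA a + ιA b * y := by rw [hy, mul_add]; abel
        _ = _ := by rw [h, hy, mul_add]; abel
    obtain ⟨h2, h3⟩ := hinj _ _ _ _ h1
    subst h3
    exact ⟨add_right_cancel h2, rfl⟩
  have hsurjy : ∀ z : X, ∃ a b : Fin n → k, ιA a + ιA b * y = z := by
    intro z
    obtain ⟨⟨a, b⟩, h⟩ := hfact.2 z
    refine ⟨a - b * c, b, ?_⟩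
    rw [← h, hy, map_sub, map_mul, mul_add]
    abel
  have hkey : ∀ g : Fin n → k, v * g = (g ∘ φ ∘ φ) * v ∧ u * (g ∘ φ) = (g ∘ φ ∘ φ) * u := by
    intro g
    apply hinjy
    have e1 : (y * y) * ιA g = ιA (g ∘ φ ∘ φ) * (y * y) := by
      rw [mul_assoc, hyg, ← mul_assoc, hyg, mul_assoc]; rfl
    rw [hyy, add_mul, mul_assoc, hyg] at e1
    simp only [map_mul]
    rw [mul_assoc, add_comm, e1, mul_add, mul_assoc, add_comm]
  have hvne : ∀ j, v j ≠ 0 := by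
    intro j h
    apply hnr (-c j)
    rw [hv] at h
    simp at h
    linear_combination -h
  have hφ : ∀ i, φ (φ i) = i := by
    intro i
    have h1 := congrFun (hkey (Pi.single i 1)).1 i
    by_contra hne
    simp [hne] at h1
    exact hvne i h1
  have hu0 : ∀ j, φ j ≠ j → u j = 0 := by
    intro j hj
    have h1 := congrFun (hkey (Pi.single j 1)).2 j
    simpa [hj, hφ] using h1.symm
  have hvφ : ∀ j, v (φ j) = v j := by
    intro j
    by_cases hj : φ j = j
    · rw [hj]
    · have h1 := hu0 j hj
      rw [hu] at h1
      rw [hv]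
      simp at h1 ⊢
      linear_combination (c j - c (φ j)) * h1
  have hcard : 2 * ((Finset.univ.filter fun i : Fin n => φ i ≠ i).card / 2) +
      (Finset.univ.filter fun i : Fin n => φ i = i).card = n := by
    have h1 := card_moved φ hφ
    have h2 := Finset.card_filter_add_card_filter_not (s := (Finset.univ : Finset (Fin n)))
      (fun i => φ i = i)
    simp only [Finset.card_univ, Fintype.card_fin] at h2
    simp only [ne_eq] at h1 ⊢
    omega
  refine ⟨hφ, hcard, ?_⟩
  have hlt : (Finset.univ.filter fun i : Fin n => i < φ i).card =
      (Finset.univ.filter fun i : Fin n => φ i ≠ i).card / 2 := by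
    rw [card_moved φ hφ]; simp
  let e1 := Finset.orderIsoOfFin _ hlt
  let e2 := Finset.orderIsoOfFin (Finset.univ.filter fun i : Fin n => φ i = i) rfl
  have he1 : ∀ i, i < φ i → ∃ s, (e1 s : Fin n) = i := fun i hi =>
    ⟨e1.symm ⟨i, by simpa using hi⟩, by simp⟩
  have he2 : ∀ i, φ i = i → ∃ s, (e2 s : Fin n) = i := fun i hi =>
    ⟨e2.symm ⟨i, by simpa using hi⟩, by simp⟩
  have he1' : ∀ s, φ (e1 s : Fin n) ≠ e1 s := fun s => by
    have := (e1 s).2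
    rw [Finset.mem_filter] at this
    exact this.2.ne'
  have he2' : ∀ s, φ (e2 s : Fin n) = e2 s := fun s => by
    have := (e2 s).2
    rw [Finset.mem_filter] at this
    exact this.2
  refine final_iso p hdeg hsq X ιA y φ u v hyg hyy hinjy hsurjy hvne hφ hu0 hvφ ?_ ?_ hcard
    (fun s => (e1 s : Fin n)) (fun s => (e2 s : Fin n)) he1 he2 he1' he2'
  · intro j hj
    rw [hu]; simp [hj, hc0 j hj]
  · intro j hj
    rw [hv]; simp [hc0 j hj]
end

section
/- Let k be a field of characteristic ≠ 2 and q, h ∈ k with q² ≠ 4αβ and h² ≠ 4αβ. The algebras C_q and C_h (with C_q = k⟨x,y⟩/(x²−α, y²−β, xy+yx−q)) are isomorphic if and only if there exist u, v ∈ k with u² − αv² = (q² − 4αβ)/(h² − 4αβ). -/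
open FreeAlgebra

/-- Relations for `C_q = k⟨x,y⟩/(x² − α, y² − β, xy + yx − q)`. -/
inductive CRel (k : Type*) [Field k] (α β q : k) :
    FreeAlgebra k (Fin 2) → FreeAlgebra k (Fin 2) → Prop
  | xx : CRel k α β q (ι k 0 * ι k 0) (algebraMap k _ α)
  | yy : CRel k α β q (ι k 1 * ι k 1) (algebraMap k _ β)
  | mix : CRel k α β q (ι k 0 * ι k 1 + ι k 1 * ι k 0) (algebraMap k _ q)

/-- The homomorphism out of `C_q` given by a pair of elements satisfying the relations. -/
noncomputable def cLift {k A : Type*} [Field k] [Ring A] [Algebra k A] (α β q : k) (X Y : A)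
    (hX : X * X = algebraMap k A α) (hY : Y * Y = algebraMap k A β)
    (hXY : X * Y + Y * X = algebraMap k A q) : RingQuot (CRel k α β q) →ₐ[k] A :=
  RingQuot.liftAlgHom k ⟨FreeAlgebra.lift k ![X, Y], by
    intro a b hab
    cases hab with
    | xx => simpa using hX
    | yy => simpa using hY
    | mix => simpa using hXY⟩

noncomputable def cx {k : Type*} [Field k] (α β q : k) : RingQuot (CRel k α β q) :=
  RingQuot.mkAlgHom k _ (ι k 0)

noncomputable def cy {k : Type*} [Field k] (α β q : k) : RingQuot (CRel k α β q) :=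
  RingQuot.mkAlgHom k _ (ι k 1)

section
variable {k : Type*} [Field k] (α β q : k)

theorem cx_cx : cx α β q * cx α β q = algebraMap k _ α := by
  have := RingQuot.mkAlgHom_rel k (CRel.xx (k := k) (α := α) (β := β) (q := q))
  simpa [cx] using this

theorem cy_cy : cy α β q * cy α β q = algebraMap k _ β := by
  have := RingQuot.mkAlgHom_rel k (CRel.yy (k := k) (α := α) (β := β) (q := q))
  simpa [cy] using this

theorem cx_cy : cx α β q * cy α β q + cy α β q * cx α β q = algebraMap k _ q := by
  have := RingQuot.mkAlgHom_rel k (CRel.mix (k := k) (α := α) (β := β) (q := q))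
  simpa [cx, cy] using this

theorem c_ext {A : Type*} [Ring A] [Algebra k A] (f g : RingQuot (CRel k α β q) →ₐ[k] A)
    (hx : f (cx α β q) = g (cx α β q)) (hy : f (cy α β q) = g (cy α β q)) : f = g := by
  apply RingQuot.ringQuot_ext'
  apply FreeAlgebra.hom_ext
  funext i
  fin_cases i
  · exact hx
  · exact hy

theorem cLift_cx {A : Type*} [Ring A] [Algebra k A] (X Y : A)
    (hX : X * X = algebraMap k A α) (hY : Y * Y = algebraMap k A β)
    (hXY : X * Y + Y * X = algebraMap k A q) : cLift α β q X Y hX hY hXY (cx α β q) = X := by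
  simp [cLift, cx]

theorem cLift_cy {A : Type*} [Ring A] [Algebra k A] (X Y : A)
    (hX : X * X = algebraMap k A α) (hY : Y * Y = algebraMap k A β)
    (hXY : X * Y + Y * X = algebraMap k A q) : cLift α β q X Y hX hY hXY (cy α β q) = Y := by
  simp [cLift, cy]

/-- The quaternion basis in `C_q`, where `q = 2αt` and `d = β - αt²`. -/
noncomputable def cBasis (t d : k) (ht : q = 2 * α * t) (hd : d = β - α * t ^ 2) :
    QuaternionAlgebra.Basis (RingQuot (CRel k α β q)) α 0 d where
  i := cx α β q
  j := cy α β q - t • cx α β q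
  k := cx α β q * (cy α β q - t • cx α β q)
  i_mul_i := by rw [cx_cx, Algebra.algebraMap_eq_smul_one]; simp
  j_mul_j := by
    have h1 := cx_cx α β q
    have h2 := cy_cy α β q
    have h3 := cx_cy α β q
    rw [Algebra.algebraMap_eq_smul_one] at h1 h2 h3
    simp only [sub_mul, mul_sub, smul_mul_assoc, mul_smul_comm]
    rw [← eq_sub_iff_add_eq] at h3
    rw [h1, h2, h3, hd, ht]
    module
  i_mul_j := rfl
  j_mul_i := by
    have h1 := cx_cx α β q
    have h3 := cx_cy α β q
    rw [Algebra.algebraMap_eq_smul_one] at h1 h3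
    simp only [sub_mul, mul_sub, smul_mul_assoc, mul_smul_comm]
    rw [← eq_sub_iff_add_eq] at h3
    rw [h1, h3, ht]
    module

/-- The map from `C_q` to the quaternion algebra. -/
noncomputable def cToQ (t d : k) (ht : q = 2 * α * t) (hd : d = β - α * t ^ 2) :
    RingQuot (CRel k α β q) →ₐ[k] QuaternionAlgebra k α 0 d :=
  cLift α β q ⟨0, 1, 0, 0⟩ ⟨0, t, 1, 0⟩
    (by ext <;> simp)
    (by subst hd; ext <;> simp <;> ring)
    (by ext <;> simp <;> rw [ht] <;> ring)

/-- `C_q` is a quaternion algebra. -/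
noncomputable def cEquiv (t d : k) (ht : q = 2 * α * t) (hd : d = β - α * t ^ 2) :
    RingQuot (CRel k α β q) ≃ₐ[k] QuaternionAlgebra k α 0 d :=
  AlgEquiv.ofAlgHom (cToQ α β q t d ht hd) (cBasis α β q t d ht hd).liftHom
    (by
      apply QuaternionAlgebra.hom_ext
      · simp [QuaternionAlgebra.Basis.lift, cBasis, cToQ, cLift_cx, cLift_cy]
      · simp [QuaternionAlgebra.Basis.lift, cBasis, cToQ, cLift_cx, cLift_cy])
    (by
      apply c_ext
      · simp [QuaternionAlgebra.Basis.lift, cBasis, cToQ, cLift_cx, cLift_cy]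
      · simp [QuaternionAlgebra.Basis.lift, cBasis, cToQ, cLift_cx, cLift_cy])

/-- The basis `i, (u + v i) j`. -/
def twistBasis (d d' u v : k) (h : d' = d * (u ^ 2 - α * v ^ 2)) :
    QuaternionAlgebra.Basis (QuaternionAlgebra k α 0 d) α 0 d' where
  i := ⟨0, 1, 0, 0⟩
  j := ⟨0, 0, u, v⟩
  k := ⟨0, 0, α * v, u⟩
  i_mul_i := by ext <;> simp
  j_mul_j := by subst h; ext <;> simp <;> ring
  i_mul_j := by ext <;> simp
  j_mul_i := by ext <;> simp

theorem twist_equiv (d d' u v : k) (h : d' = d * (u ^ 2 - α * v ^ 2))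
    (hn : u ^ 2 - α * v ^ 2 ≠ 0) :
    Nonempty (QuaternionAlgebra k α 0 d' ≃ₐ[k] QuaternionAlgebra k α 0 d) := by
  have h' : d = d' * ((u / (u ^ 2 - α * v ^ 2)) ^ 2 - α * (-v / (u ^ 2 - α * v ^ 2)) ^ 2) := by
    rw [h]
    generalize hN : u ^ 2 - α * v ^ 2 = N at *
    field_simp
    rw [← hN]
  refine ⟨AlgEquiv.ofAlgHom (twistBasis α d d' u v h).liftHom
    (twistBasis α d' d _ _ h').liftHom ?_ ?_⟩
  all_goals
    apply QuaternionAlgebra.hom_ext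
    · simp [QuaternionAlgebra.Basis.lift, twistBasis]
    · simp [QuaternionAlgebra.Basis.lift, twistBasis]
      constructor <;> field_simp <;> ring

/-- Explicit Witt cancellation. -/
theorem witt_aux (h2 : (2 : k) ≠ 0) (hα : α ≠ 0) (d d' a b c e f g : k) (hd : d ≠ 0)
    (hX : α * a ^ 2 + d * b ^ 2 - α * d * c ^ 2 = α)
    (hY : α * e ^ 2 + d * f ^ 2 - α * d * g ^ 2 = d')
    (hXY : α * a * e + d * b * f - α * d * c * g = 0) :
    ∃ u v : k, d' = d * (u ^ 2 - α * v ^ 2) := by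
  by_cases ha : a = 1
  · subst ha
    refine ⟨f - e * b / 2, g - e * c / 2, ?_⟩
    field_simp
    linear_combination (-4) * hY - e ^ 2 * hX + 4 * e * hXY
  · have ha' : 1 - a ≠ 0 := fun h => ha (sub_eq_zero.mp h).symm
    refine ⟨f + e * b / (1 - a), g + e * c / (1 - a), ?_⟩
    field_simp
    linear_combination (-(1 - a) ^ 2) * hY - e ^ 2 * hX - 2 * e * (1 - a) * hXY

theorem forward_aux (h2 : (2 : k) ≠ 0) (hα : ∀ c : k, c ^ 2 ≠ α) (d d' : k) (hd : d ≠ 0)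
    (X Y : QuaternionAlgebra k α 0 d) (hX : X * X = algebraMap k _ α)
    (hY : Y * Y = algebraMap k _ d') (hXY : X * Y + Y * X = 0) :
    ∃ u v : k, d' = d * (u ^ 2 - α * v ^ 2) := by
  have hα0 : α ≠ 0 := fun h => hα 0 (by simp [h])
  obtain ⟨p, a, b, c⟩ := X
  obtain ⟨r, e, f, g⟩ := Y
  have hX' := hX
  simp [QuaternionAlgebra.ext_iff] at hX hY hXY
  obtain ⟨x0, x1, x2, x3⟩ := hX
  obtain ⟨y0, y1, y2, y3⟩ := hY
  obtain ⟨z0, z1, z2, z3⟩ := hXY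
  have hp : p = 0 := by
    by_contra hp
    have h2p : 2 * p ≠ 0 := mul_ne_zero h2 hp
    have ha : a = 0 := by apply (mul_eq_zero.mp _).resolve_left h2p; linear_combination x1
    have hb : b = 0 := by apply (mul_eq_zero.mp _).resolve_left h2p; linear_combination x2
    have hc : c = 0 := by apply (mul_eq_zero.mp _).resolve_left h2p; linear_combination x3
    apply hα p
    subst ha hb hc
    linear_combination x0
  subst hp
  have hr : r = 0 := by
    by_contra hr
    have h2r : 2 * r ≠ 0 := mul_ne_zero h2 hr
    have ha : a = 0 := by apply (mul_eq_zero.mp _).resolve_left h2r; linear_combination z1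
    have hb : b = 0 := by apply (mul_eq_zero.mp _).resolve_left h2r; linear_combination z2
    have hc : c = 0 := by apply (mul_eq_zero.mp _).resolve_left h2r; linear_combination z3
    apply hα0
    subst ha hb hc
    linear_combination -x0
  subst hr
  apply witt_aux α h2 hα0 d d' a b c e f g hd
  · linear_combination x0
  · linear_combination y0
  · apply (mul_eq_zero.mp _).resolve_left h2
    linear_combination z0

end

/-- Over a field of characteristic ≠ 2 with `α` a non-square, and `q² ≠ 4αβ`, `h² ≠ 4αβ`,
the algebras `C_q` and `C_h` are isomorphic if, and only if, the ratio
`(q² − 4αβ)/(h² − 4αβ)` is a norm `u² − αv²` from `k(√α)`. -/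
theorem stmt14 {k : Type*} [Field k] (h2 : (2 : k) ≠ 0) (α β q h : k)
    (hα : ∀ c : k, c ^ 2 ≠ α)
    (hq : q ^ 2 ≠ 4 * α * β) (hh : h ^ 2 ≠ 4 * α * β) :
    Nonempty (RingQuot (CRel k α β q) ≃ₐ[k] RingQuot (CRel k α β h)) ↔
      ∃ u v : k, u ^ 2 - α * v ^ 2 = (q ^ 2 - 4 * α * β) / (h ^ 2 - 4 * α * β) := by
  have hα0 : α ≠ 0 := fun h => hα 0 (by simp [h])
  obtain ⟨s, hs⟩ : ∃ s, q = 2 * α * s := ⟨q / (2 * α), by field_simp⟩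
  obtain ⟨t, ht⟩ : ∃ t, h = 2 * α * t := ⟨h / (2 * α), by field_simp⟩
  obtain ⟨d', hd'⟩ : ∃ d', d' = β - α * s ^ 2 := ⟨_, rfl⟩
  obtain ⟨d, hd⟩ : ∃ d, d = β - α * t ^ 2 := ⟨_, rfl⟩
  have e1 : q ^ 2 - 4 * α * β = -4 * α * d' := by rw [hs, hd']; ring
  have e2 : h ^ 2 - 4 * α * β = -4 * α * d := by rw [ht, hd]; ring
  have hd0 : d ≠ 0 := by
    rintro rfl
    exact hh (by linear_combination e2)
  have hd0' : d' ≠ 0 := by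
    rintro rfl
    exact hq (by linear_combination e1)
  have h4 : (-4 : k) * α ≠ 0 := by
    have : (-4 : k) = -(2 * 2) := by norm_num
    rw [this]
    exact mul_ne_zero (neg_ne_zero.mpr (mul_ne_zero h2 h2)) hα0
  have key : ∀ u v : k, (u ^ 2 - α * v ^ 2 = (q ^ 2 - 4 * α * β) / (h ^ 2 - 4 * α * β) ↔
      d' = d * (u ^ 2 - α * v ^ 2)) := by
    intro u v
    rw [e1, e2, mul_div_mul_left _ _ h4, eq_div_iff hd0, mul_comm d, eq_comm]
  simp only [key]
  constructor
  · rintro ⟨φ⟩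
    let ψ := (cEquiv α β q s d' hs hd').symm.trans (φ.trans (cEquiv α β h t d ht hd))
    apply forward_aux α h2 hα d d' hd0 (ψ ⟨0, 1, 0, 0⟩) (ψ ⟨0, 0, 1, 0⟩)
    · rw [← map_mul, ← ψ.commutes]
      congr 1
      ext <;> simp
    · rw [← map_mul, ← ψ.commutes]
      congr 1
      ext <;> simp
    · rw [← map_mul, ← map_mul, ← map_add, ← map_zero ψ]
      congr 1
      ext <;> simp
  · rintro ⟨u, v, huv⟩
    obtain ⟨τ⟩ := twist_equiv α d d' u v huv (by
      intro h0
      rw [h0, mul_zero] at huv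
      exact hd0' huv)
    exact ⟨(cEquiv α β q s d' hs hd').trans (τ.trans (cEquiv α β h t d ht hd).symm)⟩
end
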